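/- arXiv:1511.07296 — 6 statements merged into one kernel-verified Lean document; each statement's English description precedes it below -/
import Mathlib

section
/- Let α ∈ ℂ, α ≠ 0, and let A be the 4-dimensional Leibniz algebra over ℂ with basis {e1,e2,e3,e4} and nonzero products [e1,e2]=α·e3+e4, [e2,e1]=−α·e3−e4, [e2,e2]=e4. Then A is isomorphic to the algebra A8 with basis {x1,x2,x3,x4} and nonzero products [x1,x1]=x4, [x1,x2]=x3, [x2,x1]=−x3. -/
noncomputable section

/-- The span of all brackets `[a, b]` with `a ∈ A`, `b ∈ S`. -/
def bracketSpan {A : Type*} [AddCommGroup A] [Module ℂ A]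
    (β : A →ₗ[ℂ] A →ₗ[ℂ] A) (S : Submodule ℂ A) : Submodule ℂ A :=
  Submodule.span ℂ {x | ∃ a : A, ∃ b ∈ S, x = β a b}

/-- `lpow β i` is `Aⁱ`: `A¹ = A` and `Aⁱ = [A, Aⁱ⁻¹]` for `i ≥ 2`
(with the convention `lpow β 0 = ⊤`). -/
def lpow {A : Type*} [AddCommGroup A] [Module ℂ A]
    (β : A →ₗ[ℂ] A →ₗ[ℂ] A) : ℕ → Submodule ℂ A
  | 0 => ⊤
  | 1 => ⊤
  | n + 2 => bracketSpan β (lpow β (n + 1))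

/-- `Leib(A)`, the span of all squares `[a, a]`. -/
def leibSpan {A : Type*} [AddCommGroup A] [Module ℂ A]
    (β : A →ₗ[ℂ] A →ₗ[ℂ] A) : Submodule ℂ A :=
  Submodule.span ℂ {x | ∃ a : A, x = β a a}

/-- The (left) Leibniz identity. -/
def IsLeibniz {A : Type*} [AddCommGroup A] [Module ℂ A]
    (β : A →ₗ[ℂ] A →ₗ[ℂ] A) : Prop :=
  ∀ a b c : A, β a (β b c) = β (β a b) c + β b (β a c)

/-- Nilpotency: some term of the lower central series vanishes. -/
def LeibNilpotent {A : Type*} [AddCommGroup A] [Module ℂ A]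
    (β : A →ₗ[ℂ] A →ₗ[ℂ] A) : Prop :=
  ∃ n : ℕ, lpow β n = ⊥

/-- The center `Z(A)` as a set. -/
def centerSet {A : Type*} [AddCommGroup A] [Module ℂ A]
    (β : A →ₗ[ℂ] A →ₗ[ℂ] A) : Set A :=
  {x | ∀ a : A, β x a = 0 ∧ β a x = 0}

/-- Two-sided ideal. -/
def LeibIsIdeal {A : Type*} [AddCommGroup A] [Module ℂ A]
    (β : A →ₗ[ℂ] A →ₗ[ℂ] A) (I : Submodule ℂ A) : Prop :=
  ∀ x ∈ I, ∀ a : A, β x a ∈ I ∧ β a x ∈ I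

/-- `A` is split if it is the (internal) direct sum of two nonzero two-sided ideals. -/
def LeibIsSplit {A : Type*} [AddCommGroup A] [Module ℂ A]
    (β : A →ₗ[ℂ] A →ₗ[ℂ] A) : Prop :=
  ∃ I J : Submodule ℂ A, LeibIsIdeal β I ∧ LeibIsIdeal β J ∧
    I ≠ ⊥ ∧ J ≠ ⊥ ∧ I ⊓ J = ⊥ ∧ I ⊔ J = ⊤

/-- Isomorphism of Leibniz algebras: a linear bijection preserving the bracket. -/
def LeibIso {A : Type*} [AddCommGroup A] [Module ℂ A]
    {B : Type*} [AddCommGroup B] [Module ℂ B]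
    (β : A →ₗ[ℂ] A →ₗ[ℂ] A) (γ : B →ₗ[ℂ] B →ₗ[ℂ] B) : Prop :=
  ∃ e : A ≃ₗ[ℂ] B, ∀ x y : A, e (β x y) = γ (e x) (e y)

/-- The bilinear product on `ℂ⁴` determined by structure constants
`f i j = [eᵢ, eⱼ]`. -/
def mkBil (f : Fin 4 → Fin 4 → Fin 4 → ℂ) :
    (Fin 4 → ℂ) →ₗ[ℂ] (Fin 4 → ℂ) →ₗ[ℂ] (Fin 4 → ℂ) :=
  LinearMap.mk₂ ℂ (fun x y => ∑ i, ∑ j, (x i * y j) • f i j)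
    (fun x x' y => by
      simp only [Pi.add_apply, add_mul, add_smul, Finset.sum_add_distrib])
    (fun c x y => by
      simp only [Pi.smul_apply, smul_eq_mul, Finset.smul_sum, mul_assoc, mul_smul])
    (fun x y y' => by
      simp only [Pi.add_apply, mul_add, add_smul, Finset.sum_add_distrib])
    (fun c x y => by
      simp only [Pi.smul_apply, smul_eq_mul, Finset.smul_sum, smul_smul, mul_left_comm])

/-- `E k` is the `k`-th standard basis vector of `ℂ⁴`. -/
def E (k : Fin 4) : Fin 4 → ℂ := Pi.single k 1

/-- Structure constants of the algebras `𝒜₁, …, 𝒜₂₅` (indices `0,1,2,3`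
correspond to `x₁, x₂, x₃, x₄`). -/
def sA1 : Fin 4 → Fin 4 → Fin 4 → ℂ :=
  ![![0, 0, E 3, 0], ![0, 0, 0, 0], ![0, E 3, 0, 0], 0]

def sA2 : Fin 4 → Fin 4 → Fin 4 → ℂ :=
  ![![0, 0, E 3, 0], ![0, E 3, E 3, 0], ![E 3, -E 3, 0, 0], 0]

def sA3 : Fin 4 → Fin 4 → Fin 4 → ℂ :=
  ![![0, E 3, 0, 0], ![-E 3, 0, 0, 0], ![0, 0, E 3, 0], 0]

def sA4 : Fin 4 → Fin 4 → Fin 4 → ℂ :=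
  ![![0, E 3, 0, 0], ![-E 3, E 3, 0, 0], ![0, 0, E 3, 0], 0]

def sA5 (c : ℂ) : Fin 4 → Fin 4 → Fin 4 → ℂ :=
  ![![0, E 3, 0, 0], ![c • E 3, 0, 0, 0], ![0, 0, E 3, 0], 0]

def sA6 : Fin 4 → Fin 4 → Fin 4 → ℂ :=
  ![![E 3, 0, 0, 0], ![0, E 3, 0, 0], ![0, 0, E 3, 0], 0]

def sA7 : Fin 4 → Fin 4 → Fin 4 → ℂ :=
  ![![E 1, E 2, E 3, 0], 0, 0, 0]

def sA8 : Fin 4 → Fin 4 → Fin 4 → ℂ :=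
  ![![E 3, E 2, 0, 0], ![-E 2, 0, 0, 0], 0, 0]

def sA9 : Fin 4 → Fin 4 → Fin 4 → ℂ :=
  ![![E 3, E 2, 0, 0], ![-E 2, E 3, 0, 0], 0, 0]

def sA10 : Fin 4 → Fin 4 → Fin 4 → ℂ :=
  ![![E 3, E 2, E 3, 0], ![-E 2, 0, 0, 0], ![-E 3, 0, 0, 0], 0]

def sA11 : Fin 4 → Fin 4 → Fin 4 → ℂ :=
  ![![0, E 2, E 3, 0], ![-E 2, E 3, 0, 0], ![-E 3, 0, 0, 0], 0]

def sA12 : Fin 4 → Fin 4 → Fin 4 → ℂ :=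
  ![![E 3, E 2, E 3, 0], ![-E 2 + E 3, 0, 0, 0], ![-E 3, 0, 0, 0], 0]

def sA13 : Fin 4 → Fin 4 → Fin 4 → ℂ :=
  ![![0, E 2, E 3, 0], ![-E 2 + E 3, E 3, 0, 0], ![-E 3, 0, 0, 0], 0]

def sA14 : Fin 4 → Fin 4 → Fin 4 → ℂ :=
  ![![E 2, E 3, 0, 0], 0, 0, 0]

def sA15 : Fin 4 → Fin 4 → Fin 4 → ℂ :=
  ![![E 2, 0, 0, 0], ![E 3, 0, 0, 0], 0, 0]

def sA16 : Fin 4 → Fin 4 → Fin 4 → ℂ :=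
  ![![0, E 3, 0, 0], ![E 2, -E 2, 0, 0], 0, 0]

def sA17 (α : ℂ) : Fin 4 → Fin 4 → Fin 4 → ℂ :=
  ![![E 2, E 3, 0, 0], ![α • E 3, 0, 0, 0], 0, 0]

def sA18 (α : ℂ) : Fin 4 → Fin 4 → Fin 4 → ℂ :=
  ![![E 2, α • E 2, 0, 0], ![E 3, -E 3, 0, 0], 0, 0]

def sA19 : Fin 4 → Fin 4 → Fin 4 → ℂ :=
  ![![E 2, E 2, 0, 0], ![E 2 + E 3, E 3, 0, 0], 0, 0]

def sA20 : Fin 4 → Fin 4 → Fin 4 → ℂ :=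
  ![![0, E 2, E 3, 0], 0, 0, 0]

def sA21 : Fin 4 → Fin 4 → Fin 4 → ℂ :=
  ![![0, E 2, E 3, 0], ![0, E 3, 0, 0], 0, 0]

def sA22 : Fin 4 → Fin 4 → Fin 4 → ℂ :=
  ![![0, E 2, E 3, 0], ![E 3, 0, 0, 0], 0, 0]

def sA23 : Fin 4 → Fin 4 → Fin 4 → ℂ :=
  ![![0, E 2, E 3, 0], ![E 3, E 3, 0, 0], 0, 0]

def sA24 : Fin 4 → Fin 4 → Fin 4 → ℂ :=
  ![![E 2, 0, E 3, 0], ![E 3, 0, 0, 0], 0, 0]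

def sA25 : Fin 4 → Fin 4 → Fin 4 → ℂ :=
  ![![E 2, 0, E 3, 0], ![0, E 3, 0, 0], 0, 0]

/-- The family `𝒜ᵢ`, `1 ≤ i ≤ 25`, with parameter `c` (used only for
`i = 5, 17, 18`). -/
def Alg : ℕ → ℂ → ((Fin 4 → ℂ) →ₗ[ℂ] (Fin 4 → ℂ) →ₗ[ℂ] (Fin 4 → ℂ))
  | 1, _ => mkBil sA1
  | 2, _ => mkBil sA2
  | 3, _ => mkBil sA3
  | 4, _ => mkBil sA4
  | 5, c => mkBil (sA5 c)
  | 6, _ => mkBil sA6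
  | 7, _ => mkBil sA7
  | 8, _ => mkBil sA8
  | 9, _ => mkBil sA9
  | 10, _ => mkBil sA10
  | 11, _ => mkBil sA11
  | 12, _ => mkBil sA12
  | 13, _ => mkBil sA13
  | 14, _ => mkBil sA14
  | 15, _ => mkBil sA15
  | 16, _ => mkBil sA16
  | 17, c => mkBil (sA17 c)
  | 18, c => mkBil (sA18 c)
  | 19, _ => mkBil sA19
  | 20, _ => mkBil sA20
  | 21, _ => mkBil sA21
  | 22, _ => mkBil sA22
  | 23, _ => mkBil sA23
  | 24, _ => mkBil sA24
  | 25, _ => mkBil sA25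
  | _, _ => 0

/-- Admissibility of the index `i` and the parameter `c` for the family `𝒜ᵢ`. -/
def Adm (i : ℕ) (c : ℂ) : Prop :=
  1 ≤ i ∧ i ≤ 25 ∧ (i = 5 → (c ≠ 1 ∧ c ≠ -1)) ∧
    (i = 17 → (c ≠ -1 ∧ c ≠ 0)) ∧ (i = 18 → c ≠ -1)

/-- Structure constants: `[e₁,e₂] = α e₃ + e₄ = -[e₂,e₁]`, `[e₂,e₂] = e₄`. -/
def s13 (α : ℂ) : Fin 4 → Fin 4 → Fin 4 → ℂ :=
  ![![0, α • E 2 + E 3, 0, 0], ![-(α • E 2 + E 3), E 3, 0, 0], 0, 0]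

/-- The change of basis `e₁ ↦ x₂`, `e₂ ↦ x₁`, `e₃ ↦ -α⁻¹ (x₃ + x₄)`, `e₄ ↦ x₄`. -/
def s13EquivA8 (α : ℂ) (hα : α ≠ 0) : (Fin 4 → ℂ) ≃ₗ[ℂ] (Fin 4 → ℂ) where
  toFun v := ![v 1, v 0, -(α⁻¹ * v 2), v 3 - α⁻¹ * v 2]
  invFun w := ![w 1, w 0, -(α * w 2), w 3 - w 2]
  map_add' v w := by
    ext i; fin_cases i <;> simp <;> ring
  map_smul' c v := by
    ext i; fin_cases i <;> simp <;> ring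
  left_inv v := by
    ext i; fin_cases i <;> simp [hα]
  right_inv w := by
    ext i; fin_cases i <;> simp [hα]

theorem stmt13 (α : ℂ) (hα : α ≠ 0) :
    LeibIso (mkBil (s13 α)) (mkBil sA8) := by
  refine ⟨s13EquivA8 α hα, fun x y => ?_⟩
  ext i
  fin_cases i <;>
    simp [s13EquivA8, mkBil, s13, sA8, E, Fin.sum_univ_four] <;>
    field_simp <;> ring
end
end

section
/- Let α ∈ ℂ, α ≠ 0, and let A be the 4-dimensional Leibniz algebra over ℂ with basis {e1,e2,e3,e4} and nonzero products [e1,e1]=e4, [e2,e2]=e4, [e1,e2]=α·e3, [e2,e1]=−α·e3. Then A is isomorphic to the algebra A9 with basis {x1,x2,x3,x4} and nonzero products [x1,x1]=x4, [x1,x2]=x3, [x2,x1]=−x3, [x2,x2]=x4. -/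
noncomputable section

/-- Structure constants: `[e₁,e₁] = e₄ = [e₂,e₂]`, `[e₁,e₂] = α e₃ = -[e₂,e₁]`. -/
def s14 (α : ℂ) : Fin 4 → Fin 4 → Fin 4 → ℂ :=
  ![![E 3, α • E 2, 0, 0], ![-(α • E 2), E 3, 0, 0], 0, 0]

theorem stmt14 (α : ℂ) (hα : α ≠ 0) :
    LeibIso (mkBil (s14 α)) (mkBil sA9) := by
  refine ⟨LinearEquiv.piCongrRight fun i =>
    LinearEquiv.smulOfNeZero ℂ ℂ (![1, 1, α⁻¹, 1] i) ?_, fun x y => ?_⟩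
  · fin_cases i <;> simp [hα]
  · ext k
    fin_cases k <;>
      simp [mkBil, s14, sA9, E, Fin.sum_univ_four] <;> field_simp
end
end

section
/- Let α, c ∈ ℂ with α ≠ 0 and c ∉ {1,−1}, and let A be the 4-dimensional Leibniz algebra over ℂ with basis {e1,e2,e3,e4} and nonzero products [e1,e2]=α·e3+e4, [e2,e1]=−α·e3+c·e4. Then A is isomorphic to the algebra A9 with basis {x1,x2,x3,x4} and nonzero products [x1,x1]=x4, [x1,x2]=x3, [x2,x1]=−x3, [x2,x2]=x4. -/
noncomputable section

/-- Structure constants: `[e₁,e₂] = α e₃ + e₄`, `[e₂,e₁] = -α e₃ + c e₄`. -/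
def s15 (α c : ℂ) : Fin 4 → Fin 4 → Fin 4 → ℂ :=
  ![![0, α • E 2 + E 3, 0, 0], ![-(α • E 2) + c • E 3, 0, 0, 0], 0, 0]

/-- The change of basis `x₁ = e₁ + e₂`, `x₂ = i(e₁ - e₂)`, `x₃ = [x₁, x₂]`, `x₄ = [x₁, x₁]`,
read as a linear equivalence from the coordinates in `x` to the coordinates in `e`. -/
def s15BasisChange (α c : ℂ) (hα : α ≠ 0) (hc : 1 + c ≠ 0) : (Fin 4 → ℂ) ≃ₗ[ℂ] (Fin 4 → ℂ) where
  toFun y := ![y 0 + Complex.I * y 1, y 0 - Complex.I * y 1,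
    -(2 * α * Complex.I * y 2), Complex.I * (c - 1) * y 2 + (1 + c) * y 3]
  map_add' x y := by
    ext k
    fin_cases k <;> simp <;> ring
  map_smul' t x := by
    ext k
    fin_cases k <;> simp <;> ring
  invFun v := ![(v 0 + v 1) / 2, -(Complex.I * (v 0 - v 1) / 2),
    Complex.I * v 2 / (2 * α), (v 3 + (c - 1) * v 2 / (2 * α)) / (1 + c)]
  left_inv y := by
    have hI := Complex.I_sq
    ext k
    fin_cases k <;> simp <;> field_simp <;> grind
  right_inv v := by
    have hI := Complex.I_sq
    ext k
    fin_cases k <;> simp <;> field_simp <;> grind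

theorem LeibIso.symm {A B : Type*} [AddCommGroup A] [Module ℂ A] [AddCommGroup B] [Module ℂ B]
    {β : A →ₗ[ℂ] A →ₗ[ℂ] A} {γ : B →ₗ[ℂ] B →ₗ[ℂ] B} (h : LeibIso β γ) : LeibIso γ β := by
  obtain ⟨e, he⟩ := h
  exact ⟨e.symm, fun x y => e.injective (by simp [he])⟩

theorem stmt15 (α c : ℂ) (hα : α ≠ 0) (hc1 : c ≠ 1) (hc2 : c ≠ -1) :
    LeibIso (mkBil (s15 α c)) (mkBil sA9) := by
  have hI := Complex.I_sq
  have hc : 1 + c ≠ 0 := fun h => hc2 (by linear_combination h)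
  refine LeibIso.symm ⟨s15BasisChange α c hα hc, fun x y => ?_⟩
  ext k
  fin_cases k <;>
    simp [s15BasisChange, mkBil, s15, sA9, E, Fin.sum_univ_four, LinearMap.mk₂_apply] <;>
    grind
end
end

section
/- Let α, β, γ ∈ ℂ with α ≠ 0, and let A be the 4-dimensional Leibniz algebra over ℂ with basis {e1,e2,e3,e4} and nonzero products [e1,e1]=e4, [e1,e2]=α·e3, [e2,e1]=−α·e3, [e1,e3]=β·e4, [e3,e1]=−β·e4, [e2,e3]=γ·e4, [e3,e2]=−γ·e4. If γ = 0 and β ≠ 0, then A is isomorphic to the algebra A10 with nonzero products [x1,x1]=x4, [x1,x2]=x3, [x2,x1]=−x3, [x1,x3]=x4, [x3,x1]=−x4. If γ ≠ 0, then A is isomorphic to the algebra A11 with nonzero products [x1,x2]=x3, [x2,x1]=−x3, [x2,x2]=x4, [x1,x3]=x4, [x3,x1]=−x4. -/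
noncomputable section

/-- Structure constants: `[e₁,e₁] = e₄`, `[e₁,e₂] = α e₃ = -[e₂,e₁]`,
`[e₁,e₃] = β e₄ = -[e₃,e₁]`, `[e₂,e₃] = γ e₄ = -[e₃,e₂]`. -/
def s16 (α β γ : ℂ) : Fin 4 → Fin 4 → Fin 4 → ℂ :=
  ![![E 3, α • E 2, β • E 3, 0], ![-(α • E 2), 0, γ • E 3, 0],
    ![-(β • E 3), -(γ • E 3), 0, 0], 0]

/-- Coordinate change from `s16 α β 0` to `sA10`, in the case `β ≠ 0`. -/
def equivA10 (α β : ℂ) (hα : α ≠ 0) (hβ : β ≠ 0) : (Fin 4 → ℂ) ≃ₗ[ℂ] (Fin 4 → ℂ) where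
  toFun v := ![v 0, α * β * v 1, β * v 2, v 3]
  invFun w := ![w 0, w 1 / (α * β), w 2 / β, w 3]
  map_add' v w := by
    ext i; fin_cases i <;> simp [mul_add]
  map_smul' c v := by
    ext i; fin_cases i <;> simp [mul_left_comm]
  left_inv v := by
    ext i; fin_cases i <;> simp <;> field_simp
  right_inv w := by
    ext i; fin_cases i <;> simp <;> field_simp

/-- Coordinate change from `s16 α β γ` to `sA11`, in the case `γ ≠ 0`. -/
def equivA11 (α β γ : ℂ) (hα : α ≠ 0) (hγ : γ ≠ 0) : (Fin 4 → ℂ) ≃ₗ[ℂ] (Fin 4 → ℂ) where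
  toFun v := ![v 1 + β / γ * v 0, -(v 0 / (α * γ)), v 2 / (α ^ 2 * γ), v 3 / (α ^ 2 * γ ^ 2)]
  invFun w := ![-(α * γ * w 1), w 0 + α * β * w 1, α ^ 2 * γ * w 2, α ^ 2 * γ ^ 2 * w 3]
  map_add' v w := by
    ext i; fin_cases i <;> simp <;> ring
  map_smul' c v := by
    ext i; fin_cases i <;> simp <;> ring
  left_inv v := by
    ext i; fin_cases i <;> simp <;> field_simp <;> ring
  right_inv w := by
    ext i; fin_cases i <;> simp <;> field_simp <;> ring

theorem stmt16 (α β γ : ℂ) (hα : α ≠ 0) :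
    (γ = 0 → β ≠ 0 → LeibIso (mkBil (s16 α β γ)) (mkBil sA10)) ∧
      (γ ≠ 0 → LeibIso (mkBil (s16 α β γ)) (mkBil sA11)) := by
  constructor
  · rintro rfl hβ
    refine ⟨equivA10 α β hα hβ, fun x y => ?_⟩
    ext i
    fin_cases i <;>
      simp [equivA10, mkBil, s16, sA10, E, Fin.sum_univ_four] <;> ring
  · intro hγ
    refine ⟨equivA11 α β γ hα hγ, fun x y => ?_⟩
    ext i
    fin_cases i <;>
      simp [equivA11, mkBil, s16, sA11, E, Fin.sum_univ_four] <;>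
      field_simp <;> ring
end
end

section
/- Let α, β, γ ∈ ℂ with α ≠ 0, and let A be the 4-dimensional Leibniz algebra over ℂ with basis {e1,e2,e3,e4} and nonzero products [e1,e1]=e4, [e2,e2]=e4, [e1,e2]=α·e3, [e2,e1]=−α·e3, [e1,e3]=β·e4, [e3,e1]=−β·e4, [e2,e3]=γ·e4, [e3,e2]=−γ·e4. If β² + γ² = 0 and β ≠ 0 and γ ≠ 0, then A is isomorphic to the algebra A12 with nonzero products [x1,x1]=x4, [x1,x2]=x3, [x2,x1]=−x3+x4, [x1,x3]=x4, [x3,x1]=−x4. If β² + γ² ≠ 0, then A is isomorphic to the algebra A13 with nonzero products [x2,x2]=x4, [x1,x2]=x3, [x2,x1]=−x3+x4, [x1,x3]=x4, [x3,x1]=−x4. -/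
noncomputable section

/-- Structure constants: `[e₁,e₁] = e₄ = [e₂,e₂]`, `[e₁,e₂] = α e₃ = -[e₂,e₁]`,
`[e₁,e₃] = β e₄ = -[e₃,e₁]`, `[e₂,e₃] = γ e₄ = -[e₃,e₂]`. -/
def s17 (α β γ : ℂ) : Fin 4 → Fin 4 → Fin 4 → ℂ :=
  ![![E 3, α • E 2, β • E 3, 0], ![-(α • E 2), E 3, γ • E 3, 0],
    ![-(β • E 3), -(γ • E 3), 0, 0], 0]

theorem mkBil_apply (f : Fin 4 → Fin 4 → Fin 4 → ℂ) (x y : Fin 4 → ℂ) :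
    mkBil f x y = ∑ i, ∑ j, (x i * y j) • f i j := rfl

theorem mkBil_s17_apply (α β γ : ℂ) (x y : Fin 4 → ℂ) :
    mkBil (s17 α β γ) x y = ![0, 0, α * (x 0 * y 1 - x 1 * y 0),
      x 0 * y 0 + x 1 * y 1 + (β * x 0 + γ * x 1) * y 2 - x 2 * (β * y 0 + γ * y 1)] := by
  ext k
  fin_cases k <;> simp [mkBil_apply, s17, Fin.sum_univ_four, E] <;> ring

theorem mkBil_sA12_apply (x y : Fin 4 → ℂ) :
    mkBil sA12 x y = ![0, 0, x 0 * y 1 - x 1 * y 0,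
      x 0 * y 0 + x 1 * y 0 + x 0 * y 2 - x 2 * y 0] := by
  ext k
  fin_cases k <;> simp [mkBil_apply, sA12, Fin.sum_univ_four, E] <;> ring

theorem mkBil_sA13_apply (x y : Fin 4 → ℂ) :
    mkBil sA13 x y = ![0, 0, x 0 * y 1 - x 1 * y 0,
      x 1 * y 1 + x 1 * y 0 + x 0 * y 2 - x 2 * y 0] := by
  ext k
  fin_cases k <;> simp [mkBil_apply, sA13, Fin.sum_univ_four, E] <;> ring

/-- The linear map sending the first two basis vectors to `p₁ e₁ + p₂ e₂` and `q₁ e₁ + q₂ e₂`,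
the third one to their bracket `d e₃ + m e₄`, and the fourth one to `t e₄`. -/
def changeOfGenerators (p₁ p₂ q₁ q₂ d m t : ℂ) : (Fin 4 → ℂ) →ₗ[ℂ] (Fin 4 → ℂ) :=
  Matrix.toLin' !![p₁, q₁, 0, 0; p₂, q₂, 0, 0; 0, 0, d, 0; 0, 0, m, t]

theorem changeOfGenerators_apply (p₁ p₂ q₁ q₂ d m t : ℂ) (x : Fin 4 → ℂ) :
    changeOfGenerators p₁ p₂ q₁ q₂ d m t x =
      ![p₁ * x 0 + q₁ * x 1, p₂ * x 0 + q₂ * x 1, d * x 2, m * x 2 + t * x 3] := by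
  ext k
  fin_cases k <;>
    simp [changeOfGenerators, Matrix.mulVec, dotProduct, Fin.sum_univ_four]

theorem changeOfGenerators_injective {p₁ p₂ q₁ q₂ d m t : ℂ} (hD : p₁ * q₂ - p₂ * q₁ ≠ 0)
    (hd : d ≠ 0) (ht : t ≠ 0) :
    Function.Injective (changeOfGenerators p₁ p₂ q₁ q₂ d m t) := by
  rw [injective_iff_map_eq_zero]
  intro x hx
  rw [changeOfGenerators_apply] at hx
  have h0 : p₁ * x 0 + q₁ * x 1 = 0 := congrFun hx 0
  have h1 : p₂ * x 0 + q₂ * x 1 = 0 := congrFun hx 1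
  have h2 : d * x 2 = 0 := congrFun hx 2
  have h3 : m * x 2 + t * x 3 = 0 := congrFun hx 3
  have x0 : x 0 = 0 := (mul_eq_zero.mp (by linear_combination q₂ * h0 - q₁ * h1 :
    (p₁ * q₂ - p₂ * q₁) * x 0 = 0)).resolve_left hD
  have x1 : x 1 = 0 := (mul_eq_zero.mp (by linear_combination p₁ * h1 - p₂ * h0 :
    (p₁ * q₂ - p₂ * q₁) * x 1 = 0)).resolve_left hD
  have x2 : x 2 = 0 := (mul_eq_zero.mp h2).resolve_left hd
  have x3 : x 3 = 0 := (mul_eq_zero.mp (by linear_combination h3 - m * x2 :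
    t * x 3 = 0)).resolve_left ht
  ext k
  fin_cases k <;> assumption

theorem LeibIso.of_injective {f g : (Fin 4 → ℂ) →ₗ[ℂ] (Fin 4 → ℂ) →ₗ[ℂ] (Fin 4 → ℂ)}
    (φ : (Fin 4 → ℂ) →ₗ[ℂ] (Fin 4 → ℂ)) (hφ : Function.Injective φ)
    (h : ∀ x y, φ (g x y) = f (φ x) (φ y)) : LeibIso f g := by
  refine ⟨(LinearEquiv.ofInjectiveEndo φ hφ).symm, fun x y => ?_⟩
  rw [LinearEquiv.symm_apply_eq]
  have key (z) : φ ((LinearEquiv.ofInjectiveEndo φ hφ).symm z) = z :=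
    (LinearEquiv.ofInjectiveEndo φ hφ).apply_symm_apply z
  simp only [LinearEquiv.coe_ofInjectiveEndo, h, key]

theorem leibIso_s17_sA12 {α β γ p₁ p₂ q₁ q₂ t : ℂ} (hα : α ≠ 0) (ht : t ≠ 0)
    (hD : p₁ * q₂ - p₂ * q₁ ≠ 0) (hpp : p₁ ^ 2 + p₂ ^ 2 = t)
    (hqq : q₁ ^ 2 + q₂ ^ 2 = 0) (hpq : 2 * (p₁ * q₁ + p₂ * q₂) = t)
    (hq : β * q₁ + γ * q₂ = 0)
    (hp : (β * p₁ + γ * p₂) * (α * (p₁ * q₂ - p₂ * q₁)) = t) :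
    LeibIso (mkBil (s17 α β γ)) (mkBil sA12) := by
  refine .of_injective (changeOfGenerators p₁ p₂ q₁ q₂ (α * (p₁ * q₂ - p₂ * q₁))
    (p₁ * q₁ + p₂ * q₂) t) (changeOfGenerators_injective hD (mul_ne_zero hα hD) ht)
    fun x y => ?_
  rw [mkBil_s17_apply, mkBil_sA12_apply]
  simp only [changeOfGenerators_apply]
  ext k
  fin_cases k <;> simp
  · ring
  · linear_combination (-x 0 * y 0) * hpp - x 1 * y 1 * hqq - x 1 * y 0 * hpq
      - (x 0 * y 2 - x 2 * y 0) * hp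
      - (α * (p₁ * q₂ - p₂ * q₁)) * (x 1 * y 2 - x 2 * y 1) * hq

theorem leibIso_s17_sA13 {α β γ p₁ p₂ q₁ q₂ t : ℂ} (hα : α ≠ 0) (ht : t ≠ 0)
    (hD : p₁ * q₂ - p₂ * q₁ ≠ 0) (hpp : p₁ ^ 2 + p₂ ^ 2 = 0)
    (hqq : q₁ ^ 2 + q₂ ^ 2 = t) (hpq : 2 * (p₁ * q₁ + p₂ * q₂) = t)
    (hq : β * q₁ + γ * q₂ = 0)
    (hp : (β * p₁ + γ * p₂) * (α * (p₁ * q₂ - p₂ * q₁)) = t) :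
    LeibIso (mkBil (s17 α β γ)) (mkBil sA13) := by
  refine .of_injective (changeOfGenerators p₁ p₂ q₁ q₂ (α * (p₁ * q₂ - p₂ * q₁))
    (p₁ * q₁ + p₂ * q₂) t) (changeOfGenerators_injective hD (mul_ne_zero hα hD) ht)
    fun x y => ?_
  rw [mkBil_s17_apply, mkBil_sA13_apply]
  simp only [changeOfGenerators_apply]
  ext k
  fin_cases k <;> simp
  · ring
  · linear_combination (-x 0 * y 0) * hpp - x 1 * y 1 * hqq - x 1 * y 0 * hpq
      - (x 0 * y 2 - x 2 * y 0) * hp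
      - (α * (p₁ * q₂ - p₂ * q₁)) * (x 1 * y 2 - x 2 * y 1) * hq

theorem stmt17 (α β γ : ℂ) (hα : α ≠ 0) :
    (β ^ 2 + γ ^ 2 = 0 → β ≠ 0 → γ ≠ 0 →
      LeibIso (mkBil (s17 α β γ)) (mkBil sA12)) ∧
      (β ^ 2 + γ ^ 2 ≠ 0 → LeibIso (mkBil (s17 α β γ)) (mkBil sA13)) := by
  constructor
  · intro hN hβ hγ
    obtain ⟨s, hs⟩ : ∃ s : ℂ, s * (α * β ^ 2) = -1 :=
      ⟨-1 / (α * β ^ 2), div_mul_cancel₀ _ (by positivity)⟩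
    have hs0 : s ≠ 0 := by rintro rfl; simp at hs
    have hr : 2 * s * γ ≠ 0 := mul_ne_zero (mul_ne_zero two_ne_zero hs0) hγ
    refine leibIso_s17_sA12 (p₁ := 2 * s * γ) (p₂ := 0) (q₁ := s * γ) (q₂ := -s * β)
      (t := (2 * s * γ) ^ 2) hα (pow_ne_zero 2 hr) ?_ (by ring) ?_ (by ring) (by ring) ?_
    · have : -(2 * s * γ * (s * β)) ≠ 0 :=
        neg_ne_zero.mpr (mul_ne_zero hr (mul_ne_zero hs0 hβ))
      convert this using 1
      ring
    · linear_combination s ^ 2 * hN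
    · linear_combination -(2 * s * γ) ^ 2 * hs
  · intro hN
    obtain ⟨s, hs⟩ : ∃ s : ℂ, s * (α * (β ^ 2 + γ ^ 2)) = 4 :=
      ⟨4 / (α * (β ^ 2 + γ ^ 2)), div_mul_cancel₀ _ (mul_ne_zero hα hN)⟩
    have hs0 : s ≠ 0 := by rintro rfl; simp at hs
    have hI := Complex.I_sq
    have ht : s ^ 2 * (β ^ 2 + γ ^ 2) ≠ 0 := mul_ne_zero (pow_ne_zero 2 hs0) hN
    set u : ℂ := s * (γ + Complex.I * β) / 2 with hu
    have hp : (β * u + γ * (u * Complex.I)) *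
        (α * (u * (-s * β) - u * Complex.I * (s * γ))) = s ^ 2 * (β ^ 2 + γ ^ 2) := by
      have hL : β * u + γ * (u * Complex.I) = Complex.I * s * (β ^ 2 + γ ^ 2) / 2 := by
        rw [hu]
        linear_combination (s * β * γ / 2) * hI
      have hD : α * (u * (-s * β) - u * Complex.I * (s * γ)) =
          -(s * α) * (β * u + γ * (u * Complex.I)) := by ring
      rw [hD, hL]
      linear_combination -(s ^ 3 * α * (β ^ 2 + γ ^ 2) ^ 2 / 4) * hI
        + (s ^ 2 * (β ^ 2 + γ ^ 2) / 4) * hs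
    refine leibIso_s17_sA13 (p₁ := u) (p₂ := u * Complex.I) (q₁ := s * γ) (q₂ := -s * β)
      (t := s ^ 2 * (β ^ 2 + γ ^ 2)) hα ht ?_ ?_ (by ring) ?_ (by ring) hp
    · intro h
      rw [h, mul_zero, mul_zero] at hp
      exact ht hp.symm
    · linear_combination u ^ 2 * hI
    · rw [hu]
      linear_combination (-s ^ 2 * β ^ 2) * hI
end
end

section
/- The 25 families of 4-dimensional Leibniz algebras A1, …, A25 over ℂ (with nonzero products on the basis {x1,x2,x3,x4} given by: (A1) [x1,x3]=x4, [x3,x2]=x4; (A2) [x1,x3]=x4, [x2,x2]=x4, [x2,x3]=x4, [x3,x1]=x4, [x3,x2]=−x4; (A3) [x1,x2]=x4, [x2,x1]=−x4, [x3,x3]=x4; (A4) [x1,x2]=x4, [x2,x1]=−x4, [x2,x2]=x4, [x3,x3]=x4; (A5) [x1,x2]=x4, [x2,x1]=c·x4, [x3,x3]=x4, c ∈ ℂ\{1,−1}; (A6) [x1,x1]=x4, [x2,x2]=x4, [x3,x3]=x4; (A7) [x1,x1]=x2, [x1,x2]=x3, [x1,x3]=x4; (A8) [x1,x1]=x4,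 [x1,x2]=x3, [x2,x1]=−x3; (A9) [x1,x1]=x4, [x1,x2]=x3, [x2,x1]=−x3, [x2,x2]=x4; (A10) [x1,x1]=x4, [x1,x2]=x3, [x2,x1]=−x3, [x1,x3]=x4, [x3,x1]=−x4; (A11) [x1,x2]=x3, [x2,x1]=−x3, [x2,x2]=x4, [x1,x3]=x4, [x3,x1]=−x4; (A12) [x1,x1]=x4, [x1,x2]=x3, [x2,x1]=−x3+x4, [x1,x3]=x4, [x3,x1]=−x4; (A13) [x2,x2]=x4, [x1,x2]=x3, [x2,x1]=−x3+x4, [x1,x3]=x4, [x3,x1]=−x4; (A14) [x1,x1]=x3, [x1,x2]=x4; (A15) [x1,x1]=x3, [x2,x1]=x4; (A16) [x1,x2]=x4, [x2,x1]=x3, [x2,x2]=−x3; (A17) [x1,x1]=x3, [x1,x2]=x4, [x2,x1]=α·x4, α ∈ ℂ\{−1,0}; (A18) [x1,x1]=x3, [x2,x1]=x4, [x1,x2]=α·x3, [x2,x2]=−x4, α ∈ ℂ\{−1}; (A19) [x1,x1]=x3, [x1,x2]=x3, [x2,x1]=x3+x4, [x2,x2]=x4; (A20) [x1,x2]=x3,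 [x1,x3]=x4; (A21) [x1,x2]=x3, [x2,x2]=x4, [x1,x3]=x4; (A22) [x1,x2]=x3, [x2,x1]=x4, [x1,x3]=x4; (A23) [x1,x2]=x3, [x2,x1]=x4, [x2,x2]=x4, [x1,x3]=x4; (A24) [x1,x1]=x3, [x2,x1]=x4, [x1,x3]=x4; (A25) [x1,x1]=x3, [x2,x2]=x4, [x1,x3]=x4) are pairwise non-isomorphic: for i ≠ j, no algebra belonging to the family A_i (for any admissible value of its parameter) is isomorphic to any algebra belonging to the family A_j (for any admissible value of its parameter). -/
noncomputable section

section Invariants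

variable {A : Type*} [AddCommGroup A] [Module ℂ A]

/-- Every product `[x, [y, z]]` vanishes. -/
def RightNilTwo (β : A →ₗ[ℂ] A →ₗ[ℂ] A) : Prop :=
  ∀ x y z, β x (β y z) = 0

/-- Every product `[x, [y, [z, w]]]` vanishes. -/
def RightNilThree (β : A →ₗ[ℂ] A →ₗ[ℂ] A) : Prop :=
  ∀ x y z w, β x (β y (β z w)) = 0

/-- Products act trivially from the left. -/
def LeftNilTwo (β : A →ₗ[ℂ] A →ₗ[ℂ] A) : Prop :=
  ∀ x y z, β (β x y) z = 0

/-- All products lie on one line. -/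
def DerivedOnLine (β : A →ₗ[ℂ] A →ₗ[ℂ] A) : Prop :=
  ∃ t, ∀ x y, ∃ c : ℂ, β x y = c • t

/-- All squares lie on one line. -/
def SquaresOnLine (β : A →ₗ[ℂ] A →ₗ[ℂ] A) : Prop :=
  ∃ t, ∀ x, ∃ c : ℂ, β x x = c • t

/-- The bracket is commutative. -/
def Commutes (β : A →ₗ[ℂ] A →ₗ[ℂ] A) : Prop :=
  ∀ x y, β x y = β y x

/-- The bracket is commutative up to elements annihilated by all left multiplications. -/
def CommutesModRightKernel (β : A →ₗ[ℂ] A →ₗ[ℂ] A) : Prop :=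
  ∀ x y z, β z (β x y) = β z (β y x)

/-- Any two elements of square zero anticommute. -/
def NullAnticommute (β : A →ₗ[ℂ] A →ₗ[ℂ] A) : Prop :=
  ∀ x y, β x x = 0 → β y y = 0 → β x y + β y x = 0

/-- An element anticommuting with everything lies in the left kernel. -/
def AnticommutantLeftNull (β : A →ₗ[ℂ] A →ₗ[ℂ] A) : Prop :=
  ∀ x, (∀ y, β x y + β y x = 0) → ∀ y, β x y = 0

/-- An element commuting with everything has square zero. -/
def CommutantNull (β : A →ₗ[ℂ] A →ₗ[ℂ] A) : Prop :=
  ∀ x, (∀ y, β x y = β y x) → β x x = 0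

/-- The left kernel is contained in the right kernel. -/
def LeftKernelLeRight (β : A →ₗ[ℂ] A →ₗ[ℂ] A) : Prop :=
  ∀ x, (∀ y, β x y = 0) → ∀ y, β y x = 0

/-- The right kernel is contained in the left kernel. -/
def RightKernelLeLeft (β : A →ₗ[ℂ] A →ₗ[ℂ] A) : Prop :=
  ∀ x, (∀ y, β y x = 0) → ∀ y, β x y = 0

/-- Elements of square zero lie in the left kernel. -/
def NullLeftKernel (β : A →ₗ[ℂ] A →ₗ[ℂ] A) : Prop :=
  ∀ x, β x x = 0 → ∀ y, β x y = 0

/-- Vanishing of a product does not depend on the order of the factors. -/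
def ZeroProductSymmetric (β : A →ₗ[ℂ] A →ₗ[ℂ] A) : Prop :=
  ∀ x y, β x y = 0 → β y x = 0

/-- Factors of vanishing products can be interchanged, away from elements of square zero. -/
def ZeroProductExchange (β : A →ₗ[ℂ] A →ₗ[ℂ] A) : Prop :=
  ∀ x y z w, β x y = 0 → β z w = 0 → β x w = 0 ∨ β z z = 0 ∨ β y y = 0

/-- Elements annihilating all products from the left have square zero. -/
def DerivedCentralizerNull (β : A →ₗ[ℂ] A →ₗ[ℂ] A) : Prop :=
  ∀ x, (∀ y z, β x (β y z) = 0) → β x x = 0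

/-- Elements annihilating all products from the left lie in the left kernel. -/
def DerivedCentralizerLeftKernel (β : A →ₗ[ℂ] A →ₗ[ℂ] A) : Prop :=
  ∀ x, (∀ y z, β x (β y z) = 0) → ∀ y, β x y = 0

/-- Elements annihilating all products from the left annihilate every `y` whose left multiples
are annihilated by all left multiplications. -/
def DerivedCentralizerPairing (β : A →ₗ[ℂ] A →ₗ[ℂ] A) : Prop :=
  ∀ x y, (∀ z w, β x (β z w) = 0) → (∀ z w, β z (β w y) = 0) → β x y = 0

end Invariants

section Coordinates

variable (c : ℂ) (x y : Fin 4 → ℂ)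

@[simp]
theorem alg_1_apply : Alg 1 c x y =
    ![0, 0, 0, x 0 * y 2 + x 2 * y 1] := by
  ext k
  fin_cases k <;> simp [Alg, mkBil, sA1, E, Fin.sum_univ_four]

@[simp]
theorem alg_2_apply : Alg 2 c x y =
    ![0, 0, 0,
      x 0 * y 2 + x 1 * y 1 + x 1 * y 2 + x 2 * y 0 - x 2 * y 1] := by
  ext k
  fin_cases k <;> simp [Alg, mkBil, sA2, E, Fin.sum_univ_four]
  all_goals ring

@[simp]
theorem alg_3_apply : Alg 3 c x y =
    ![0, 0, 0, x 0 * y 1 - x 1 * y 0 + x 2 * y 2] := by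
  ext k
  fin_cases k <;> simp [Alg, mkBil, sA3, E, Fin.sum_univ_four]
  all_goals ring

@[simp]
theorem alg_4_apply : Alg 4 c x y =
    ![0, 0, 0,
      x 0 * y 1 - x 1 * y 0 + x 1 * y 1 + x 2 * y 2] := by
  ext k
  fin_cases k <;> simp [Alg, mkBil, sA4, E, Fin.sum_univ_four]
  all_goals ring

@[simp]
theorem alg_5_apply : Alg 5 c x y =
    ![0, 0, 0, x 0 * y 1 + c * (x 1 * y 0) + x 2 * y 2] := by
  ext k
  fin_cases k <;> simp [Alg, mkBil, sA5, E, Fin.sum_univ_four]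
  all_goals ring

@[simp]
theorem alg_6_apply : Alg 6 c x y =
    ![0, 0, 0, x 0 * y 0 + x 1 * y 1 + x 2 * y 2] := by
  ext k
  fin_cases k <;> simp [Alg, mkBil, sA6, E, Fin.sum_univ_four]

@[simp]
theorem alg_7_apply : Alg 7 c x y =
    ![0, x 0 * y 0, x 0 * y 1, x 0 * y 2] := by
  ext k
  fin_cases k <;> simp [Alg, mkBil, sA7, E, Fin.sum_univ_four]

@[simp]
theorem alg_8_apply : Alg 8 c x y =
    ![0, 0, x 0 * y 1 - x 1 * y 0, x 0 * y 0] := by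
  ext k
  fin_cases k <;> simp [Alg, mkBil, sA8, E, Fin.sum_univ_four]
  all_goals ring

@[simp]
theorem alg_9_apply : Alg 9 c x y =
    ![0, 0, x 0 * y 1 - x 1 * y 0, x 0 * y 0 + x 1 * y 1] := by
  ext k
  fin_cases k <;> simp [Alg, mkBil, sA9, E, Fin.sum_univ_four]
  all_goals ring

@[simp]
theorem alg_10_apply : Alg 10 c x y =
    ![0, 0, x 0 * y 1 - x 1 * y 0, x 0 * y 0 + x 0 * y 2 - x 2 * y 0] := by
  ext k
  fin_cases k <;> simp [Alg, mkBil, sA10, E, Fin.sum_univ_four]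
  all_goals ring

@[simp]
theorem alg_11_apply : Alg 11 c x y =
    ![0, 0, x 0 * y 1 - x 1 * y 0, x 1 * y 1 + x 0 * y 2 - x 2 * y 0] := by
  ext k
  fin_cases k <;> simp [Alg, mkBil, sA11, E, Fin.sum_univ_four]
  all_goals ring

@[simp]
theorem alg_12_apply : Alg 12 c x y =
    ![0, 0, x 0 * y 1 - x 1 * y 0,
      x 0 * y 0 + x 1 * y 0 + x 0 * y 2 - x 2 * y 0] := by
  ext k
  fin_cases k <;> simp [Alg, mkBil, sA12, E, Fin.sum_univ_four]
  all_goals ring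

@[simp]
theorem alg_13_apply : Alg 13 c x y =
    ![0, 0, x 0 * y 1 - x 1 * y 0,
      x 1 * y 1 + x 1 * y 0 + x 0 * y 2 - x 2 * y 0] := by
  ext k
  fin_cases k <;> simp [Alg, mkBil, sA13, E, Fin.sum_univ_four]
  all_goals ring

@[simp]
theorem alg_14_apply : Alg 14 c x y =
    ![0, 0, x 0 * y 0, x 0 * y 1] := by
  ext k
  fin_cases k <;> simp [Alg, mkBil, sA14, E, Fin.sum_univ_four]

@[simp]
theorem alg_15_apply : Alg 15 c x y =
    ![0, 0, x 0 * y 0, x 1 * y 0] := by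
  ext k
  fin_cases k <;> simp [Alg, mkBil, sA15, E, Fin.sum_univ_four]

@[simp]
theorem alg_16_apply : Alg 16 c x y =
    ![0, 0, x 1 * y 0 - x 1 * y 1, x 0 * y 1] := by
  ext k
  fin_cases k <;> simp [Alg, mkBil, sA16, E, Fin.sum_univ_four]
  all_goals ring

@[simp]
theorem alg_17_apply : Alg 17 c x y =
    ![0, 0, x 0 * y 0, x 0 * y 1 + c * (x 1 * y 0)] := by
  ext k
  fin_cases k <;> simp [Alg, mkBil, sA17, E, Fin.sum_univ_four]
  all_goals ring

@[simp]
theorem alg_18_apply : Alg 18 c x y =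
    ![0, 0, x 0 * y 0 + c * (x 0 * y 1), x 1 * y 0 - x 1 * y 1] := by
  ext k
  fin_cases k <;> simp [Alg, mkBil, sA18, E, Fin.sum_univ_four]
  all_goals ring

@[simp]
theorem alg_19_apply : Alg 19 c x y =
    ![0, 0, x 0 * y 0 + x 0 * y 1 + x 1 * y 0, x 1 * y 0 + x 1 * y 1] := by
  ext k
  fin_cases k <;> simp [Alg, mkBil, sA19, E, Fin.sum_univ_four]

@[simp]
theorem alg_20_apply : Alg 20 c x y =
    ![0, 0, x 0 * y 1, x 0 * y 2] := by
  ext k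
  fin_cases k <;> simp [Alg, mkBil, sA20, E, Fin.sum_univ_four]

@[simp]
theorem alg_21_apply : Alg 21 c x y =
    ![0, 0, x 0 * y 1, x 1 * y 1 + x 0 * y 2] := by
  ext k
  fin_cases k <;> simp [Alg, mkBil, sA21, E, Fin.sum_univ_four]
  all_goals ring

@[simp]
theorem alg_22_apply : Alg 22 c x y =
    ![0, 0, x 0 * y 1, x 1 * y 0 + x 0 * y 2] := by
  ext k
  fin_cases k <;> simp [Alg, mkBil, sA22, E, Fin.sum_univ_four]
  all_goals ring

@[simp]
theorem alg_23_apply : Alg 23 c x y =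
    ![0, 0, x 0 * y 1, x 1 * y 0 + x 1 * y 1 + x 0 * y 2] := by
  ext k
  fin_cases k <;> simp [Alg, mkBil, sA23, E, Fin.sum_univ_four]
  all_goals ring

@[simp]
theorem alg_24_apply : Alg 24 c x y =
    ![0, 0, x 0 * y 0, x 1 * y 0 + x 0 * y 2] := by
  ext k
  fin_cases k <;> simp [Alg, mkBil, sA24, E, Fin.sum_univ_four]
  all_goals ring

@[simp]
theorem alg_25_apply : Alg 25 c x y =
    ![0, 0, x 0 * y 0, x 1 * y 1 + x 0 * y 2] := by
  ext k
  fin_cases k <;> simp [Alg, mkBil, sA25, E, Fin.sum_univ_four]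
  all_goals ring

end Coordinates

section Transfer

variable {A B : Type*} [AddCommGroup A] [Module ℂ A] [AddCommGroup B] [Module ℂ B]
  {β : A →ₗ[ℂ] A →ₗ[ℂ] A} {γ : B →ₗ[ℂ] B →ₗ[ℂ] B}

theorem LeibIso.rightNilTwo_iff (h : LeibIso β γ) : RightNilTwo β ↔ RightNilTwo γ := by
  obtain ⟨e, he⟩ := h
  simp only [RightNilTwo, e.surjective.forall, ← he, EmbeddingLike.map_eq_zero_iff]

theorem LeibIso.rightNilThree_iff (h : LeibIso β γ) : RightNilThree β ↔ RightNilThree γ := by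
  obtain ⟨e, he⟩ := h
  simp only [RightNilThree, e.surjective.forall, ← he, EmbeddingLike.map_eq_zero_iff]

theorem LeibIso.leftNilTwo_iff (h : LeibIso β γ) : LeftNilTwo β ↔ LeftNilTwo γ := by
  obtain ⟨e, he⟩ := h
  simp only [LeftNilTwo, e.surjective.forall, ← he, EmbeddingLike.map_eq_zero_iff]

theorem LeibIso.derivedOnLine_iff (h : LeibIso β γ) : DerivedOnLine β ↔ DerivedOnLine γ := by
  obtain ⟨e, he⟩ := h
  simp only [DerivedOnLine, e.surjective.forall, e.surjective.exists, ← he, ← map_smul,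
    e.injective.eq_iff]

theorem LeibIso.squaresOnLine_iff (h : LeibIso β γ) : SquaresOnLine β ↔ SquaresOnLine γ := by
  obtain ⟨e, he⟩ := h
  simp only [SquaresOnLine, e.surjective.forall, e.surjective.exists, ← he, ← map_smul,
    e.injective.eq_iff]

theorem LeibIso.commutes_iff (h : LeibIso β γ) : Commutes β ↔ Commutes γ := by
  obtain ⟨e, he⟩ := h
  simp only [Commutes, e.surjective.forall, ← he, e.injective.eq_iff]

theorem LeibIso.commutesModRightKernel_iff (h : LeibIso β γ) :
    CommutesModRightKernel β ↔ CommutesModRightKernel γ := by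
  obtain ⟨e, he⟩ := h
  simp only [CommutesModRightKernel, e.surjective.forall, ← he, e.injective.eq_iff]

theorem LeibIso.nullAnticommute_iff (h : LeibIso β γ) : NullAnticommute β ↔ NullAnticommute γ := by
  obtain ⟨e, he⟩ := h
  simp only [NullAnticommute, e.surjective.forall, ← he, ← map_add, EmbeddingLike.map_eq_zero_iff]

theorem LeibIso.anticommutantLeftNull_iff (h : LeibIso β γ) :
    AnticommutantLeftNull β ↔ AnticommutantLeftNull γ := by
  obtain ⟨e, he⟩ := h
  simp only [AnticommutantLeftNull, e.surjective.forall, ← he, ← map_add,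
    EmbeddingLike.map_eq_zero_iff]

theorem LeibIso.commutantNull_iff (h : LeibIso β γ) : CommutantNull β ↔ CommutantNull γ := by
  obtain ⟨e, he⟩ := h
  simp only [CommutantNull, e.surjective.forall, ← he, EmbeddingLike.map_eq_zero_iff,
    e.injective.eq_iff]

theorem LeibIso.leftKernelLeRight_iff (h : LeibIso β γ) :
    LeftKernelLeRight β ↔ LeftKernelLeRight γ := by
  obtain ⟨e, he⟩ := h
  simp only [LeftKernelLeRight, e.surjective.forall, ← he, EmbeddingLike.map_eq_zero_iff]

theorem LeibIso.rightKernelLeLeft_iff (h : LeibIso β γ) :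
    RightKernelLeLeft β ↔ RightKernelLeLeft γ := by
  obtain ⟨e, he⟩ := h
  simp only [RightKernelLeLeft, e.surjective.forall, ← he, EmbeddingLike.map_eq_zero_iff]

theorem LeibIso.nullLeftKernel_iff (h : LeibIso β γ) : NullLeftKernel β ↔ NullLeftKernel γ := by
  obtain ⟨e, he⟩ := h
  simp only [NullLeftKernel, e.surjective.forall, ← he, EmbeddingLike.map_eq_zero_iff]

theorem LeibIso.zeroProductSymmetric_iff (h : LeibIso β γ) :
    ZeroProductSymmetric β ↔ ZeroProductSymmetric γ := by
  obtain ⟨e, he⟩ := h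
  simp only [ZeroProductSymmetric, e.surjective.forall, ← he, EmbeddingLike.map_eq_zero_iff]

theorem LeibIso.zeroProductExchange_iff (h : LeibIso β γ) :
    ZeroProductExchange β ↔ ZeroProductExchange γ := by
  obtain ⟨e, he⟩ := h
  simp only [ZeroProductExchange, e.surjective.forall, ← he, EmbeddingLike.map_eq_zero_iff]

theorem LeibIso.derivedCentralizerNull_iff (h : LeibIso β γ) :
    DerivedCentralizerNull β ↔ DerivedCentralizerNull γ := by
  obtain ⟨e, he⟩ := h
  simp only [DerivedCentralizerNull, e.surjective.forall, ← he, EmbeddingLike.map_eq_zero_iff]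

theorem LeibIso.derivedCentralizerLeftKernel_iff (h : LeibIso β γ) :
    DerivedCentralizerLeftKernel β ↔ DerivedCentralizerLeftKernel γ := by
  obtain ⟨e, he⟩ := h
  simp only [DerivedCentralizerLeftKernel, e.surjective.forall, ← he, EmbeddingLike.map_eq_zero_iff]

theorem LeibIso.derivedCentralizerPairing_iff (h : LeibIso β γ) :
    DerivedCentralizerPairing β ↔ DerivedCentralizerPairing γ := by
  obtain ⟨e, he⟩ := h
  simp only [DerivedCentralizerPairing, e.surjective.forall, ← he, EmbeddingLike.map_eq_zero_iff]

end Transfer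

theorem not_derivedOnLine {β : (Fin 4 → ℂ) →ₗ[ℂ] (Fin 4 → ℂ) →ₗ[ℂ] (Fin 4 → ℂ)}
    (x y z w : Fin 4 → ℂ) (h : β x y 2 * β z w 3 - β x y 3 * β z w 2 ≠ 0) :
    ¬ DerivedOnLine β := by
  rintro ⟨t, ht⟩
  obtain ⟨a, ha⟩ := ht x y
  obtain ⟨b, hb⟩ := ht z w
  apply h
  simp only [ha, hb, Pi.smul_apply, smul_eq_mul]
  ring

theorem not_squaresOnLine {β : (Fin 4 → ℂ) →ₗ[ℂ] (Fin 4 → ℂ) →ₗ[ℂ] (Fin 4 → ℂ)}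
    (x y : Fin 4 → ℂ) (h : β x x 2 * β y y 3 - β x x 3 * β y y 2 ≠ 0) :
    ¬ SquaresOnLine β := by
  rintro ⟨t, ht⟩
  obtain ⟨a, ha⟩ := ht x
  obtain ⟨b, hb⟩ := ht y
  apply h
  simp only [ha, hb, Pi.smul_apply, smul_eq_mul]
  ring

section Tables

variable {i : ℕ} {c : ℂ}

theorem rightNilTwo_alg (h : Adm i c) :
    RightNilTwo (Alg i c) ↔ i ≤ 6 ∨ i = 8 ∨ i = 9 ∨ 14 ≤ i ∧ i ≤ 19 := by
  obtain ⟨h₁, h₂, -⟩ := h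
  constructor
  · intro h
    have := h ![1, 0, 0, 0] ![1, 0, 0, 0] ![1, 1, 0, 0]
    contrapose! this
    have hi : i = 7 ∨ i = 10 ∨ i = 11 ∨ i = 12 ∨ i = 13 ∨ i = 20 ∨ i = 21 ∨ i = 22 ∨ i = 23 ∨
      i = 24 ∨ i = 25 := by omega
    rcases hi with rfl | rfl | rfl | rfl | rfl | rfl | rfl | rfl | rfl | rfl | rfl <;> simp
  · intro hi x y z
    interval_cases i <;> first | omega | simp

theorem rightNilThree_alg (h : Adm i c) : RightNilThree (Alg i c) ↔ i ≠ 7 := by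
  obtain ⟨h₁, h₂, -⟩ := h
  constructor
  · rintro h rfl
    simpa using h ![1, 0, 0, 0] ![1, 0, 0, 0] ![1, 0, 0, 0] ![1, 0, 0, 0]
  · intro hi x y z w
    interval_cases i <;> first | omega | simp

theorem leftNilTwo_alg (hi : 10 ≤ i ∧ i ≤ 13 ∨ 20 ≤ i ∧ i ≤ 25) :
    LeftNilTwo (Alg i c) ↔ 20 ≤ i := by
  constructor
  · intro h
    have := h ![1, 0, 0, 0] ![0, 1, 0, 0] ![1, 0, 0, 0]
    contrapose! this
    have hi : i = 10 ∨ i = 11 ∨ i = 12 ∨ i = 13 := by omega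
    rcases hi with rfl | rfl | rfl | rfl <;> simp
  · intro hi x y z
    have hi : i = 20 ∨ i = 21 ∨ i = 22 ∨ i = 23 ∨ i = 24 ∨ i = 25 := by omega
    rcases hi with rfl | rfl | rfl | rfl | rfl | rfl <;> simp

theorem derivedCentralizerNull_alg (hi : 10 ≤ i ∧ i ≤ 13 ∨ 20 ≤ i ∧ i ≤ 25) :
    DerivedCentralizerNull (Alg i c) ↔ i = 10 ∨ i = 12 ∨ i = 20 ∨ i = 22 ∨ i = 24 := by
  constructor
  · intro h
    have := h ![0, 1, 0, 0]
    contrapose! this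
    have hi : i = 11 ∨ i = 13 ∨ i = 21 ∨ i = 23 ∨ i = 25 := by omega
    rcases hi with rfl | rfl | rfl | rfl | rfl <;> simp
  · intro hi x hx
    have := hx ![1, 0, 0, 0] ![1, 1, 0, 0]
    rcases hi with rfl | rfl | rfl | rfl | rfl <;> simp_all

theorem nullAnticommute_alg (h : Adm i c) (hi : i ≤ 5 ∨ 8 ≤ i ∧ i ≤ 13) :
    NullAnticommute (Alg i c) ↔ i = 3 ∨ i = 8 ∨ i = 10 ∨ i = 11 := by
  obtain ⟨h₁, -, h₅, -⟩ := h
  constructor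
  · intro h
    contrapose! h
    have hi : i = 1 ∨ i = 2 ∨ i = 4 ∨ i = 5 ∨ i = 9 ∨ i = 12 ∨ i = 13 := by omega
    simp only [NullAnticommute, not_forall]
    rcases hi with rfl | rfl | rfl | rfl | rfl | rfl | rfl
    · exact ⟨![1, 0, 0, 0], ![0, 0, 1, 0], by simp⟩
    · exact ⟨![1, 0, 0, 0], ![0, 0, 1, 0], by simp⟩
    · exact ⟨![0, 1, Complex.I, 0], ![0, 1, -Complex.I, 0], by simp⟩
    · refine ⟨![1, 0, 0, 0], ![0, 1, 0, 0], by simp, by simp, ?_⟩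
      simpa using fun hc => (h₅ rfl).2 (by linear_combination hc)
    · exact ⟨![1, Complex.I, 0, 0], ![1, -Complex.I, 0, 0], by simp⟩
    · exact ⟨![0, 1, 0, 0], ![1, -1, 0, 0], by simp⟩
    · exact ⟨![1, 0, 0, 0], ![1, -1, 0, 0], by simp⟩
  · intro hi x y hx hy
    rcases hi with rfl | rfl | rfl | rfl <;> simp at hx hy ⊢ <;> grind

theorem commutesModRightKernel_alg (hi : 20 ≤ i ∧ i ≤ 25) :
    CommutesModRightKernel (Alg i c) ↔ i = 24 ∨ i = 25 := by
  constructor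
  · intro h
    have := h ![1, 0, 0, 0] ![0, 1, 0, 0] ![1, 0, 0, 0]
    contrapose! this
    have hi : i = 20 ∨ i = 21 ∨ i = 22 ∨ i = 23 := by omega
    rcases hi with rfl | rfl | rfl | rfl <;> simp
  · intro hi x y z
    rcases hi with rfl | rfl <;> simp [mul_comm]

theorem derivedCentralizerLeftKernel_alg (hi : i = 20 ∨ i = 22) :
    DerivedCentralizerLeftKernel (Alg i c) ↔ i = 20 := by
  constructor
  · intro h
    rcases hi with rfl | rfl
    · rfl
    · simpa using h ![0, 1, 0, 0] (by simp) ![1, 0, 0, 0]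
  · rintro rfl x hx y
    have := hx ![1, 0, 0, 0] ![0, 1, 0, 0]
    simp_all

theorem derivedCentralizerPairing_alg (hi : i = 21 ∨ i = 23) :
    DerivedCentralizerPairing (Alg i c) ↔ i = 21 := by
  constructor
  · intro h
    rcases hi with rfl | rfl
    · rfl
    · simpa using h ![0, 1, 0, 0] ![1, 0, 0, 0] (by simp) (by simp)
  · rintro rfl x y hx hy
    have := hx ![1, 0, 0, 0] ![0, 1, 0, 0]
    have := hy ![1, 0, 0, 0] ![1, 0, 0, 0]
    simp_all

theorem derivedOnLine_alg (hi : 1 ≤ i ∧ i ≤ 6 ∨ i = 8 ∨ i = 9 ∨ 14 ≤ i ∧ i ≤ 19) :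
    DerivedOnLine (Alg i c) ↔ i ≤ 6 := by
  constructor
  · intro h
    contrapose! h
    have hi : i = 8 ∨ i = 9 ∨ i = 14 ∨ i = 15 ∨ i = 16 ∨ i = 17 ∨ i = 18 ∨ i = 19 := by omega
    rcases hi with rfl | rfl | rfl | rfl | rfl | rfl | rfl | rfl
    · exact not_derivedOnLine ![1, 0, 0, 0] ![0, 1, 0, 0] ![1, 0, 0, 0] ![1, 0, 0, 0] (by simp)
    · exact not_derivedOnLine ![1, 0, 0, 0] ![0, 1, 0, 0] ![1, 0, 0, 0] ![1, 0, 0, 0] (by simp)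
    · exact not_derivedOnLine ![1, 0, 0, 0] ![1, 0, 0, 0] ![1, 0, 0, 0] ![0, 1, 0, 0] (by simp)
    · exact not_derivedOnLine ![1, 0, 0, 0] ![1, 0, 0, 0] ![0, 1, 0, 0] ![1, 0, 0, 0] (by simp)
    · exact not_derivedOnLine ![0, 1, 0, 0] ![1, 0, 0, 0] ![1, 0, 0, 0] ![0, 1, 0, 0] (by simp)
    · exact not_derivedOnLine ![1, 0, 0, 0] ![1, 0, 0, 0] ![1, 0, 0, 0] ![0, 1, 0, 0] (by simp)
    · exact not_derivedOnLine ![1, 0, 0, 0] ![1, 0, 0, 0] ![0, 1, 0, 0] ![1, 0, 0, 0] (by simp)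
    · exact not_derivedOnLine ![1, 0, 0, 0] ![1, 0, 0, 0] ![0, 1, 0, 0] ![0, 1, 0, 0] (by simp)
  · intro h
    have hi : i = 1 ∨ i = 2 ∨ i = 3 ∨ i = 4 ∨ i = 5 ∨ i = 6 := by omega
    refine ⟨![0, 0, 0, 1], fun x y => ⟨Alg i c x y 3, ?_⟩⟩
    rcases hi with rfl | rfl | rfl | rfl | rfl | rfl <;> simp

theorem commutes_alg (h : Adm i c) (hi : 1 ≤ i ∧ i ≤ 6) : Commutes (Alg i c) ↔ i = 6 := by
  obtain ⟨-, -, h₅, -⟩ := h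
  constructor
  · intro h
    by_contra h₆
    have hi : i = 1 ∨ i = 2 ∨ i = 3 ∨ i = 4 ∨ i = 5 := by omega
    rcases hi with rfl | rfl | rfl | rfl | rfl
    · simpa using h ![1, 0, 0, 0] ![0, 0, 1, 0]
    · have := h ![0, 1, 0, 0] ![0, 0, 1, 0]
      simp at this
      norm_num at this
    · have := h ![1, 0, 0, 0] ![0, 1, 0, 0]
      simp at this
      norm_num at this
    · have := h ![1, 0, 0, 0] ![0, 1, 0, 0]
      simp at this
      norm_num at this
    · have := h ![1, 0, 0, 0] ![0, 1, 0, 0]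
      simp at this
      exact (h₅ rfl).1 this.symm
  · rintro rfl x y
    simp [mul_comm]

theorem anticommutantLeftNull_alg (h : Adm i c) (hi : i = 1 ∨ i = 2 ∨ i = 4 ∨ i = 5) :
    AnticommutantLeftNull (Alg i c) ↔ i = 2 ∨ i = 5 := by
  obtain ⟨-, -, h₅, -⟩ := h
  constructor
  · intro h
    rcases hi with rfl | rfl | rfl | rfl
    · simpa using h ![1, -1, 0, 0] (by simp) ![0, 0, 1, 0]
    · simp
    · simpa using h ![1, 0, 0, 0] (by simp) ![0, 1, 0, 0]
    · simp
  · intro hi x hx y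
    have e₀ := hx ![1, 0, 0, 0]
    have e₁ := hx ![0, 1, 0, 0]
    have e₂ := hx ![0, 0, 1, 0]
    rcases hi with rfl | rfl
    · simp at e₀ e₁ e₂ ⊢
      grind
    · have hc : 1 + c ≠ 0 := fun hc => (h₅ rfl).2 (by linear_combination hc)
      simp at e₀ e₁ e₂ ⊢
      grind

theorem commutantNull_alg (hi : i = 2 ∨ i = 5) :
    CommutantNull (Alg i c) ↔ i = 2 := by
  constructor
  · intro h
    rcases hi with rfl | rfl
    · rfl
    · simpa using h ![0, 0, 1, 0] (by simp)
  · rintro rfl x hx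
    have e₀ := hx ![1, 0, 0, 0]
    have e₁ := hx ![0, 1, 0, 0]
    have e₂ := hx ![0, 0, 1, 0]
    simp at e₀ e₁ e₂ ⊢
    grind

theorem leftKernelLeRight_alg (h : Adm i c) (hi : i = 1 ∨ i = 4 ∨ 14 ≤ i ∧ i ≤ 19) :
    LeftKernelLeRight (Alg i c) ↔ i ≠ 1 ∧ i ≠ 14 := by
  obtain ⟨-, -, -, h₁₇, -⟩ := h
  constructor
  · intro h
    constructor
    · rintro rfl
      simpa using h ![0, 1, 0, 0] (by simp) ![0, 0, 1, 0]
    · rintro rfl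
      simpa using h ![0, 1, 0, 0] (by simp) ![1, 0, 0, 0]
  · intro hi' x hx y
    have e₀ := hx ![1, 0, 0, 0]
    have e₁ := hx ![0, 1, 0, 0]
    have e₂ := hx ![0, 0, 1, 0]
    have hi : i = 4 ∨ i = 15 ∨ i = 16 ∨ i = 17 ∨ i = 18 ∨ i = 19 := by omega
    rcases hi with rfl | rfl | rfl | rfl | rfl | rfl <;> simp at e₀ e₁ e₂ ⊢ <;> grind

theorem rightKernelLeLeft_alg (h : Adm i c) (hi : 15 ≤ i ∧ i ≤ 19) :
    RightKernelLeLeft (Alg i c) ↔ i ≠ 15 := by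
  obtain ⟨-, -, -, h₁₇, h₁₈⟩ := h
  constructor
  · rintro h rfl
    simpa using h ![0, 1, 0, 0] (by simp) ![1, 0, 0, 0]
  · intro hi' x hx y
    have e₀ := hx ![1, 0, 0, 0]
    have e₁ := hx ![0, 1, 0, 0]
    have hi : i = 16 ∨ i = 17 ∨ i = 18 ∨ i = 19 := by omega
    rcases hi with rfl | rfl | rfl | rfl <;> simp at e₀ e₁ ⊢ <;> grind

theorem squaresOnLine_alg (h : Adm i c) (hi : i = 8 ∨ i = 9 ∨ 14 ≤ i ∧ i ≤ 19) :
    SquaresOnLine (Alg i c) ↔ i = 8 ∨ i = 9 := by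
  obtain ⟨-, -, -, h₁₇, h₁₈⟩ := h
  constructor
  · intro h
    contrapose! h
    have hi : i = 14 ∨ i = 15 ∨ i = 16 ∨ i = 17 ∨ i = 18 ∨ i = 19 := by omega
    rcases hi with rfl | rfl | rfl | rfl | rfl | rfl
    · exact not_squaresOnLine ![1, 0, 0, 0] ![1, 1, 0, 0] (by simp)
    · exact not_squaresOnLine ![1, 0, 0, 0] ![1, 1, 0, 0] (by simp)
    · exact not_squaresOnLine ![0, 1, 0, 0] ![1, 1, 0, 0] (by simp)
    · refine not_squaresOnLine ![1, 0, 0, 0] ![1, 1, 0, 0] ?_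
      simpa using fun hc => (h₁₇ rfl).1 (by linear_combination hc)
    · exact not_squaresOnLine ![1, 0, 0, 0] ![0, 1, 0, 0] (by simp)
    · exact not_squaresOnLine ![1, 0, 0, 0] ![0, 1, 0, 0] (by simp)
  · intro hi
    refine ⟨![0, 0, 0, 1], fun x => ⟨Alg i c x x 3, ?_⟩⟩
    rcases hi with rfl | rfl <;> simp [mul_comm]

theorem nullLeftKernel_alg (h : Adm i c) (hi : 16 ≤ i ∧ i ≤ 19) :
    NullLeftKernel (Alg i c) ↔ i = 18 ∨ i = 19 := by
  obtain ⟨-, -, -, h₁₇, h₁₈⟩ := h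
  constructor
  · intro h
    contrapose! h
    have hi : i = 16 ∨ i = 17 := by omega
    simp only [NullLeftKernel, not_forall]
    rcases hi with rfl | rfl
    · exact ⟨![1, 0, 0, 0], by simp, ![0, 1, 0, 0], by simp⟩
    · exact ⟨![0, 1, 0, 0], by simp, ![1, 0, 0, 0], by simpa using (h₁₇ rfl).2⟩
  · intro hi x hx y
    rcases hi with rfl | rfl <;> simp at hx ⊢ <;> grind

theorem zeroProductSymmetric_alg (h : Adm i c) (hi : i = 16 ∨ i = 17) :
    ZeroProductSymmetric (Alg i c) ↔ i = 17 := by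
  obtain ⟨-, -, -, h₁₇, -⟩ := h
  constructor
  · intro h
    rcases hi with rfl | rfl
    · simpa using h ![0, 1, 0, 0] ![1, 1, 0, 0]
    · rfl
  · rintro rfl x y hx
    simp at hx ⊢
    grind

theorem zeroProductExchange_alg (h : Adm i c) (hi : i = 18 ∨ i = 19) :
    ZeroProductExchange (Alg i c) ↔ i = 19 := by
  obtain ⟨-, -, -, -, h₁₈⟩ := h
  constructor
  · intro h
    rcases hi with rfl | rfl
    · have := h ![0, 1, 0, 0] ![1, 1, 0, 0] ![1, 0, 0, 0] ![c, -1, 0, 0] (by simp) (by simp)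
      simp at this
      grind
    · rfl
  · rintro rfl x y z w h₁ h₂
    simp at h₁ h₂ ⊢
    grind

end Tables

/-- Isomorphic members of two families have indices in the same coarse block. -/
theorem LeibIso.same_block {i j : ℕ} {c d : ℂ} (hi : Adm i c) (hj : Adm j d)
    (e : LeibIso (Alg i c) (Alg j d)) :
    i = j ∨ i ≤ 6 ∧ j ≤ 6 ∨ (i = 8 ∨ i = 9) ∧ (j = 8 ∨ j = 9) ∨
      (14 ≤ i ∧ i ≤ 19) ∧ 14 ≤ j ∧ j ≤ 19 ∨ (10 ≤ i ∧ i ≤ 13) ∧ 10 ≤ j ∧ j ≤ 13 ∨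
      20 ≤ i ∧ 20 ≤ j := by
  have r₂ := (rightNilTwo_alg hi).symm.trans (e.rightNilTwo_iff.trans (rightNilTwo_alg hj))
  have r₃ := (rightNilThree_alg hi).symm.trans (e.rightNilThree_iff.trans (rightNilThree_alg hj))
  have l₂ := fun a b => (leftNilTwo_alg a).symm.trans
    (e.leftNilTwo_iff.trans (leftNilTwo_alg b))
  have dd := fun a b => (derivedOnLine_alg a).symm.trans
    (e.derivedOnLine_iff.trans (derivedOnLine_alg b))
  have sq := fun a b => (squaresOnLine_alg hi a).symm.trans
    (e.squaresOnLine_iff.trans (squaresOnLine_alg hj b))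
  obtain ⟨hi₁, hi₂, -⟩ := hi
  obtain ⟨hj₁, hj₂, -⟩ := hj
  clear e
  grind

/-- The families `𝒜₁, …, 𝒜₂₅` are pairwise non-isomorphic: for `i ≠ j`, no
member of the family `𝒜ᵢ` (for any admissible parameter value) is isomorphic
to any member of the family `𝒜ⱼ`. -/
theorem families_pairwise_nonisomorphic :
    ∀ (i j : ℕ) (c d : ℂ), Adm i c → Adm j d → i ≠ j →
      ¬ LeibIso (Alg i c) (Alg j d) := by
  intro i j c d hi hj hij e
  have na := fun a b => (nullAnticommute_alg hi a).symm.trans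
    (e.nullAnticommute_iff.trans (nullAnticommute_alg hj b))
  have lr := fun a b => (leftKernelLeRight_alg hi a).symm.trans
    (e.leftKernelLeRight_iff.trans (leftKernelLeRight_alg hj b))
  have dn := fun a b => (derivedCentralizerNull_alg a).symm.trans
    (e.derivedCentralizerNull_iff.trans (derivedCentralizerNull_alg b))
  have hi₁ := hi.1
  have hi₂ := hi.2.1
  have hj₁ := hj.1
  have hj₂ := hj.2.1
  rcases e.same_block hi hj with h | h | h | h | h | h
  · exact hij h
  · have cm := fun a b => (commutes_alg hi a).symm.trans
      (e.commutes_iff.trans (commutes_alg hj b))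
    have al := fun a b => (anticommutantLeftNull_alg hi a).symm.trans
      (e.anticommutantLeftNull_iff.trans (anticommutantLeftNull_alg hj b))
    have cn := fun a b => (commutantNull_alg a).symm.trans
      (e.commutantNull_iff.trans (commutantNull_alg b))
    clear dn hi hj e
    grind
  · clear hi hj e
    grind
  · have rl := fun a b => (rightKernelLeLeft_alg hi a).symm.trans
      (e.rightKernelLeLeft_iff.trans (rightKernelLeLeft_alg hj b))
    have nl := fun a b => (nullLeftKernel_alg hi a).symm.trans
      (e.nullLeftKernel_iff.trans (nullLeftKernel_alg hj b))
    have zs := fun a b => (zeroProductSymmetric_alg hi a).symm.trans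
      (e.zeroProductSymmetric_iff.trans (zeroProductSymmetric_alg hj b))
    have ze := fun a b => (zeroProductExchange_alg hi a).symm.trans
      (e.zeroProductExchange_iff.trans (zeroProductExchange_alg hj b))
    clear na dn hi hj e
    grind
  · clear hi hj e
    grind
  · have cr := fun a b => (commutesModRightKernel_alg a).symm.trans
      (e.commutesModRightKernel_iff.trans (commutesModRightKernel_alg b))
    have dl := fun a b => (derivedCentralizerLeftKernel_alg a).symm.trans
      (e.derivedCentralizerLeftKernel_iff.trans (derivedCentralizerLeftKernel_alg b))
    have dp := fun a b => (derivedCentralizerPairing_alg a).symm.trans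
      (e.derivedCentralizerPairing_iff.trans (derivedCentralizerPairing_alg b))
    clear na lr hi hj e
    grind
end
end
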